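/- Let $\delta\in(\tfrac12,1)$, $\alpha>0$ and $T_0>0$, and set $x_\star=\big(\alpha\delta(1-\delta)T_0\big)^{\frac{1}{1-\delta}}$ and $y_\star=\big(\alpha\,\delta^{\delta}\,(1-\delta)\big)^{\frac{1}{1-\delta}}$. Let $y:[0,\infty)\to[0,\infty)$ be continuous on $[0,\infty)$, differentiable on $(0,\infty)$, with $y(0)\le x_\star$ and $y'(t)+\alpha\,y(t)^{\delta}\le y_\star\,\big(\max(T_0-t,0)\big)^{\frac{\delta}{1-\delta}}$ for all $t>0$. Then $y(t)=0$ for every $t\ge T_0$. -/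

import Mathlib

/-- A continuous function that starts out nonpositive and is nonincreasing wherever it is positive
stays nonpositive. -/
theorem nonpos_right_of_deriv_nonpos_of_pos {w : ℝ → ℝ} {a b : ℝ} (hab : a ≤ b)
    (hc : ContinuousOn w (Set.Icc a b)) (ha : w a ≤ 0)
    (hd : ∀ t ∈ Set.Ioo a b, DifferentiableAt ℝ w t)
    (hw : ∀ t ∈ Set.Ioo a b, 0 < w t → deriv w t ≤ 0) : w b ≤ 0 := by
  have hcl : IsCompact (Set.Icc a b ∩ w ⁻¹' Set.Iic 0) :=
    isCompact_Icc.of_isClosed_subset (hc.preimage_isClosed_of_isClosed isClosed_Icc isClosed_Iic)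
      Set.inter_subset_left
  obtain ⟨s, ⟨hs, hws⟩, hmax⟩ := hcl.exists_isGreatest ⟨a, ⟨le_rfl, hab⟩, ha⟩
  have hanti : AntitoneOn w (Set.Icc s b) := by
    apply antitoneOn_of_deriv_nonpos (convex_Icc s b) (hc.mono (Set.Icc_subset_Icc_left hs.1))
    · rw [interior_Icc]
      exact fun t ht => (hd t ⟨hs.1.trans_lt ht.1, ht.2⟩).differentiableWithinAt
    · rw [interior_Icc]
      intro t ht
      refine hw t ⟨hs.1.trans_lt ht.1, ht.2⟩ ?_
      by_contra! h
      exact ht.1.not_ge (hmax ⟨⟨hs.1.trans ht.1.le, ht.2.le⟩, h⟩)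
  exact (hanti ⟨le_rfl, hs.2⟩ ⟨hs.2, le_rfl⟩ hs.2).trans hws

/-- The profile `(αδ(1-δ)s)^{1/(1-δ)}`, with `s` the time left before extinction, is an exact
solution of the forced equation. -/
theorem extinction_profile_identity {δ α s : ℝ} (hδ : 0 < δ) (hδ1 : δ < 1) (hα : 0 < α)
    (hs : 0 < s) :
    -(α * δ * (1 - δ)) * (1 / (1 - δ)) * (α * δ * (1 - δ) * s) ^ (1 / (1 - δ) - 1)
        + α * ((α * δ * (1 - δ) * s) ^ (1 / (1 - δ))) ^ δ
      = (α * δ ^ δ * (1 - δ)) ^ (1 / (1 - δ)) * s ^ (δ / (1 - δ)) := by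
  have h1 : 0 < 1 - δ := sub_pos.2 hδ1
  have hexp : 1 / (1 - δ) - 1 = δ / (1 - δ) := by field_simp; ring
  have hexp' : 1 / (1 - δ) = 1 + δ / (1 - δ) := by rw [← hexp]; ring
  have hpow : (δ ^ δ) ^ (1 / (1 - δ)) = δ ^ (δ / (1 - δ)) := by
    rw [← Real.rpow_mul hδ.le, mul_one_div]
  have hα1 : (α * (1 - δ)) ^ (1 / (1 - δ)) = α * (1 - δ) * (α * (1 - δ)) ^ (δ / (1 - δ)) := by
    rw [hexp', Real.rpow_add (by positivity), Real.rpow_one]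
  have hy : (α * δ ^ δ * (1 - δ)) ^ (1 / (1 - δ))
      = α * (1 - δ) * (α * (1 - δ)) ^ (δ / (1 - δ)) * δ ^ (δ / (1 - δ)) := by
    rw [mul_right_comm, Real.mul_rpow (by positivity) (by positivity), hpow, hα1]
  have hk : (α * δ * (1 - δ) * s) ^ (δ / (1 - δ))
      = (α * (1 - δ)) ^ (δ / (1 - δ)) * δ ^ (δ / (1 - δ)) * s ^ (δ / (1 - δ)) := by
    rw [Real.mul_rpow (by positivity) hs.le, mul_right_comm,
      Real.mul_rpow (by positivity) hδ.le]
  rw [← Real.rpow_mul (by positivity), one_div_mul_eq_div, hexp, hy, hk]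
  field_simp
  ring

/-- Extinction exactly from the time `T₀` at which the forcing vanishes: if `½ < δ < 1`,
`α > 0`, `T₀ > 0`, `x⋆ = (αδ(1-δ)T₀)^{1/(1-δ)}`, `y⋆ = (α δ^δ (1-δ))^{1/(1-δ)}`, and `y` is a
nonnegative continuous function on `[0, ∞)`, differentiable on `(0, ∞)`, with `y 0 ≤ x⋆` and
`y' + α y^δ ≤ y⋆ (max (T₀ - t) 0)^{δ/(1-δ)}` for `t > 0`, then `y t = 0` for all `t ≥ T₀`. -/
theorem stmt17 (δ α T₀ : ℝ) (hδ : 1 / 2 < δ) (hδ1 : δ < 1) (hα : 0 < α) (hT₀ : 0 < T₀)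
    (xstar ystar : ℝ)
    (hx : xstar = (α * δ * (1 - δ) * T₀) ^ (1 / (1 - δ)))
    (hy : ystar = (α * δ ^ δ * (1 - δ)) ^ (1 / (1 - δ)))
    (y : ℝ → ℝ) (hy_nonneg : ∀ t, 0 ≤ t → 0 ≤ y t)
    (hy_cont : ContinuousOn y (Set.Ici (0 : ℝ)))
    (hy_diff : ∀ t, 0 < t → DifferentiableAt ℝ y t)
    (hy0 : y 0 ≤ xstar)
    (hy_ineq : ∀ t, 0 < t →
      deriv y t + α * y t ^ δ ≤ ystar * max (T₀ - t) 0 ^ (δ / (1 - δ))) :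
    ∀ t, T₀ ≤ t → y t = 0 := by
  have hδ0 : 0 < δ := by linarith
  have h1 : 0 < 1 - δ := sub_pos.2 hδ1
  have hp : 1 ≤ 1 / (1 - δ) := by rw [le_div_iff₀ h1]; linarith
  set z : ℝ → ℝ := fun t => (α * δ * (1 - δ) * (T₀ - t)) ^ (1 / (1 - δ)) with hz
  have hz_deriv (t : ℝ) : HasDerivAt z (-(α * δ * (1 - δ)) * (1 / (1 - δ)) *
      (α * δ * (1 - δ) * (T₀ - t)) ^ (1 / (1 - δ) - 1)) t := by
    rw [← mul_neg_one]
    exact (((hasDerivAt_id t).const_sub T₀).const_mul (α * δ * (1 - δ))).rpow_const (Or.inr hp)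
  have hz_diff (t : ℝ) : DifferentiableAt ℝ z t := (hz_deriv t).differentiableAt
  have hyT₀ : y T₀ ≤ 0 := by
    have key : (y - z) T₀ ≤ 0 := by
      refine nonpos_right_of_deriv_nonpos_of_pos hT₀.le ?_ ?_ ?_ ?_
      · exact (hy_cont.mono Set.Icc_subset_Ici_self).sub
          fun t _ => (hz_diff t).continuousAt.continuousWithinAt
      · simpa [hz, hx] using hy0
      · exact fun t ht => (hy_diff t ht.1).sub (hz_diff t)
      · intro t ht hpos
        have hs : 0 < T₀ - t := sub_pos.2 ht.2
        have hzt : 0 ≤ z t := by positivity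
        have hpow : z t ^ δ ≤ y t ^ δ :=
          Real.rpow_le_rpow hzt (sub_pos.1 hpos).le hδ0.le
        have hineq := hy_ineq t ht.1
        rw [max_eq_left hs.le, hy, ← extinction_profile_identity hδ0 hδ1 hα hs] at hineq
        rw [deriv_sub (hy_diff t ht.1) (hz_diff t), (hz_deriv t).deriv]
        have := mul_le_mul_of_nonneg_left hpow hα.le
        simp only [hz] at this
        linarith
    have hzT₀ : z T₀ = 0 := by
      simp [hz, h1.ne']
    simpa [hzT₀] using key
  intro t ht
  refine le_antisymm ?_ (hy_nonneg t (hT₀.le.trans ht))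
  refine nonpos_right_of_deriv_nonpos_of_pos ht
    (hy_cont.mono (Set.Icc_subset_Ici_self.trans (Set.Ici_subset_Ici.2 hT₀.le))) hyT₀
    (fun s hs => hy_diff s (hT₀.trans hs.1)) fun s hs hpos => ?_
  have hineq := hy_ineq s (hT₀.trans hs.1)
  rw [max_eq_right (sub_nonpos.2 hs.1.le), Real.zero_rpow (div_pos hδ0 h1).ne', mul_zero] at hineq
  have : 0 ≤ α * y s ^ δ := by positivity
  linarith
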